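/- arXiv:1103.5288 — 7 statements merged into one kernel-verified Lean document; each statement's English description precedes it below -/
import Mathlib

section
/- Let (X,≤) be a partially ordered set with a metric d such that (X,d) is a complete metric space. Let F : X×X → X have the mixed g-monotone property, where g : X → X is continuous, commutes with F, and F(X×X) ⊆ g(X). Suppose there exists φ ∈ Φ such that for all x,y,u,v ∈ X with g(x) ≥ g(u) and g(y) ≤ g(v), d(F(x,y),F(u,v)) + d(F(y,x),F(v,u)) ≤ 2·φ((d(g(x),g(u)) + d(g(y),g(v)))/2). Assume F is continuous. If there exist x₀, y₀ ∈ X with g(x₀) ≤ F(x₀,y₀) and g(y₀) ≥ F(y₀,x₀), or with g(x₀) ≥ F(x₀,y₀) and g(y₀) ≤ F(y₀,x₀), then there exist x̄, ȳ ∈ X with g(x̄) = F(x̄,ȳ) and g(ȳ) = F(ȳ,x̄); that is, F and g have a coupled coincidence point. -/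
open Filter Topology

/-- `φ ∈ Φ`: a function `φ : [0,∞) → [0,∞)` (modelled on `ℝ`, mapping nonnegatives to
nonnegatives) such that `φ t < t` for all `t > 0` and the right limit of `φ` at every
`t > 0` exists and is less than `t`. -/
def IsPhiFun (φ : ℝ → ℝ) : Prop :=
  (∀ t : ℝ, 0 ≤ t → 0 ≤ φ t) ∧
  (∀ t : ℝ, 0 < t → φ t < t) ∧
  (∀ t : ℝ, 0 < t → ∃ L : ℝ, L < t ∧ Filter.Tendsto φ (nhdsWithin t (Set.Ioi t)) (nhds L))

/-- `F` has the mixed `g`-monotone property. -/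
def MixedGMonotone {X : Type*} [Preorder X] (g : X → X) (F : X → X → X) : Prop :=
  (∀ y x₁ x₂ : X, g x₁ ≤ g x₂ → F x₁ y ≤ F x₂ y) ∧
  (∀ x y₁ y₂ : X, g y₁ ≤ g y₂ → F x y₂ ≤ F x y₁)

/-- Assumption (*) on the ordered metric space `X`. -/
def AssumptionStar (X : Type*) [Preorder X] [MetricSpace X] : Prop :=
  (∀ (u : ℕ → X) (x : X), Monotone u → Filter.Tendsto u Filter.atTop (nhds x) → ∀ n, u n ≤ x) ∧
  (∀ (u : ℕ → X) (x : X), Antitone u → Filter.Tendsto u Filter.atTop (nhds x) → ∀ n, x ≤ u n)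

/-- The partial order on `X × X`: `(u,v) ≤ (x,y)` iff `u ≤ x` and `y ≤ v`. -/
def PairLe {X : Type*} [Preorder X] (p q : X × X) : Prop :=
  p.1 ≤ q.1 ∧ q.2 ≤ p.2

/-- Two pairs are comparable in the product order if one is `≤` the other. -/
def PairComparable {X : Type*} [Preorder X] (p q : X × X) : Prop :=
  PairLe p q ∨ PairLe q p

/-- A positive sequence with `δ (n + 1) ≤ φ (δ n)` tends to zero. -/
theorem IsPhiFun.tendsto_zero {φ : ℝ → ℝ} (hφ : IsPhiFun φ) {δ : ℕ → ℝ}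
    (hpos : ∀ n, 0 < δ n) (hstep : ∀ n, δ (n + 1) ≤ φ (δ n)) :
    Tendsto δ atTop (𝓝 0) := by
  have hanti : StrictAnti δ :=
    strictAnti_nat_of_succ_lt fun n => (hstep n).trans_lt (hφ.2.1 _ (hpos n))
  have hbdd : BddBelow (Set.range δ) := ⟨0, by rintro _ ⟨n, rfl⟩; exact (hpos n).le⟩
  have hlim := tendsto_atTop_ciInf hanti.antitone hbdd
  have hgt : ∀ n, (⨅ i, δ i) < δ n := fun n =>
    (ciInf_le hbdd (n + 1)).trans_lt (hanti n.lt_succ_self)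
  rcases (le_ciInf fun n => (hpos n).le : 0 ≤ ⨅ i, δ i).eq_or_lt with h | h
  · rwa [← h] at hlim
  · obtain ⟨L, hL, hφL⟩ := hφ.2.2 _ h
    have hright : Tendsto δ atTop (𝓝[>] (⨅ i, δ i)) :=
      tendsto_nhdsWithin_iff.2 ⟨hlim, Eventually.of_forall hgt⟩
    have := le_of_tendsto_of_tendsto' (hlim.comp (tendsto_add_atTop_nat 1))
      (hφL.comp hright) hstep
    exact absurd this hL.not_ge

/-- A pseudodistance `D` on `ℕ` contracted by `φ` under the shift, with nonzero consecutive
distances, satisfies the Cauchy condition. -/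
theorem IsPhiFun.exists_forall_lt {φ : ℝ → ℝ} (hφ : IsPhiFun φ) {D : ℕ → ℕ → ℝ}
    (hself : ∀ n, D n n = 0) (hnonneg : ∀ m n, 0 ≤ D m n)
    (htri : ∀ m k n, D m n ≤ D m k + D k n) (hpos : ∀ n, 0 < D (n + 1) n)
    (hstep : ∀ m n, n ≤ m → D (m + 1) (n + 1) ≤ φ (D m n)) {ε : ℝ} (hε : 0 < ε) :
    ∃ N, ∀ n, N ≤ n → ∀ m, n ≤ m → D m n < 2 * ε := by
  have hδ := hφ.tendsto_zero hpos fun n => hstep (n + 1) n n.le_succ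
  obtain ⟨L, hL, hφL⟩ := hφ.2.2 ε hε
  obtain ⟨u, hu, hsub⟩ := mem_nhdsGT_iff_exists_Ioo_subset.1 (hφL.eventually_lt_const hL)
  have hη : 0 < min (u - ε) ε := lt_min (sub_pos.2 hu) hε
  obtain ⟨N, hN⟩ := eventually_atTop.1 (hδ.eventually_lt_const hη)
  refine ⟨N, fun n hn m hm => ?_⟩
  have hηε := min_le_right (u - ε) ε
  have hηu := min_le_left (u - ε) ε
  suffices D m n < ε + min (u - ε) ε by linarith
  induction m, hm using Nat.le_induction with
  | base => rw [hself]; linarith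
  | succ m hm ih =>
    have hn' := hN n hn
    have hm' := hN m (hn.trans hm)
    rcases (hnonneg m n).eq_or_lt with h | h
    · have := htri (m + 1) m n
      linarith
    · have h1 := htri (m + 1) (n + 1) n
      have h2 := hstep m n hm
      have h3 : φ (D m n) ≤ ε := by
        rcases le_or_gt (D m n) ε with hle | hlt
        · exact (hφ.2.1 _ h).le.trans hle
        · exact (show φ (D m n) < ε from hsub ⟨hlt, by linarith⟩).le
      linarith

theorem coupled_coincidence_of_phi_contraction_of_continuous
    {X : Type*} [MetricSpace X] [CompleteSpace X] [PartialOrder X]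
    (F : X → X → X) (g : X → X)
    (hmono : MixedGMonotone g F)
    (hgcont : Continuous g)
    (hcomm : ∀ x y : X, g (F x y) = F (g x) (g y))
    (hrange : ∀ x y : X, F x y ∈ Set.range g)
    (φ : ℝ → ℝ) (hφ : IsPhiFun φ)
    (hcontr : ∀ x y u v : X, g u ≤ g x → g y ≤ g v →
      dist (F x y) (F u v) + dist (F y x) (F v u) ≤
        2 * φ ((dist (g x) (g u) + dist (g y) (g v)) / 2))
    (hFcont : Continuous (Function.uncurry F))
    (x₀ y₀ : X)
    (h0 : (g x₀ ≤ F x₀ y₀ ∧ F y₀ x₀ ≤ g y₀) ∨ (F x₀ y₀ ≤ g x₀ ∧ g y₀ ≤ F y₀ x₀)) :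
    ∃ x y : X, g x = F x y ∧ g y = F y x := by
  wlog h : g x₀ ≤ F x₀ y₀ ∧ F y₀ x₀ ≤ g y₀ generalizing x₀ y₀
  · have h' := h0.resolve_left h
    exact this y₀ x₀ (Or.inl h'.symm) h'.symm
  choose s hs using hrange
  let p : ℕ → X × X := fun n => (fun q : X × X => (s q.1 q.2, s q.2 q.1))^[n] (x₀, y₀)
  have hp : ∀ n, p (n + 1) = (s (p n).1 (p n).2, s (p n).2 (p n).1) := fun n =>
    Function.iterate_succ_apply' _ _ _
  have hx : ∀ n, g (p (n + 1)).1 = F (p n).1 (p n).2 := fun n => by rw [hp]; exact hs _ _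
  have hy : ∀ n, g (p (n + 1)).2 = F (p n).2 (p n).1 := fun n => by rw [hp]; exact hs _ _
  have hord : ∀ n, g (p n).1 ≤ g (p (n + 1)).1 ∧ g (p (n + 1)).2 ≤ g (p n).2 := by
    intro n
    induction n with
    | zero => rw [hx, hy]; exact h
    | succ n ih =>
      constructor
      · rw [hx (n + 1), hx n]
        exact (hmono.1 _ _ _ ih.1).trans (hmono.2 _ _ _ ih.2)
      · rw [hy (n + 1), hy n]
        exact (hmono.1 _ _ _ ih.2).trans (hmono.2 _ _ _ ih.1)
  have hmonox : Monotone fun n => g (p n).1 := monotone_nat_of_le_succ fun n => (hord n).1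
  have hantiy : Antitone fun n => g (p n).2 := antitone_nat_of_succ_le fun n => (hord n).2
  let D : ℕ → ℕ → ℝ := fun m n =>
    (dist (g (p m).1) (g (p n).1) + dist (g (p m).2) (g (p n).2)) / 2
  have hnonneg : ∀ m n, 0 ≤ D m n := fun m n => by positivity
  by_cases hz : ∃ n, D (n + 1) n = 0
  · obtain ⟨n, hn⟩ := hz
    have h1 : 0 ≤ dist (g (p (n + 1)).1) (g (p n).1) := dist_nonneg
    have h2 : 0 ≤ dist (g (p (n + 1)).2) (g (p n).2) := dist_nonneg
    have h3 : (dist (g (p (n + 1)).1) (g (p n).1) + dist (g (p (n + 1)).2) (g (p n).2)) / 2 = 0 :=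
      hn
    refine ⟨(p n).1, (p n).2, ?_, ?_⟩
    · rw [← hx]; exact (dist_eq_zero.1 (by linarith)).symm
    · rw [← hy]; exact (dist_eq_zero.1 (by linarith)).symm
  have hpos : ∀ n, 0 < D (n + 1) n := fun n =>
    (hnonneg _ _).lt_of_ne' fun h => hz ⟨n, h⟩
  have hself : ∀ n, D n n = 0 := fun n => by simp [D]
  have htri : ∀ m k n, D m n ≤ D m k + D k n := fun m k n => by
    have h1 := dist_triangle (g (p m).1) (g (p k).1) (g (p n).1)
    have h2 := dist_triangle (g (p m).2) (g (p k).2) (g (p n).2)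
    simp only [D]
    linarith
  have hstep : ∀ m n, n ≤ m → D (m + 1) (n + 1) ≤ φ (D m n) := fun m n hnm => by
    have := hcontr (p m).1 (p m).2 (p n).1 (p n).2 (hmonox hnm) (hantiy hnm)
    simp only [D, hx, hy]
    linarith
  have hcau : ∀ ε > 0, ∃ N, ∀ n, N ≤ n → ∀ m, n ≤ m → D m n < ε / 2 := fun ε hε => by
    obtain ⟨N, hN⟩ := hφ.exists_forall_lt hself hnonneg htri hpos hstep (ε := ε / 4) (by positivity)
    exact ⟨N, fun n hn m hm => (hN n hn m hm).trans_eq (by ring)⟩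
  have hcx : CauchySeq fun n => g (p n).1 := Metric.cauchySeq_iff'.2 fun ε hε => by
    obtain ⟨N, hN⟩ := hcau ε hε
    refine ⟨N, fun m hm => ?_⟩
    have h1 := hN N le_rfl m hm
    have h2 : 0 ≤ dist (g (p m).2) (g (p N).2) := dist_nonneg
    simp only [D] at h1
    linarith
  have hcy : CauchySeq fun n => g (p n).2 := Metric.cauchySeq_iff'.2 fun ε hε => by
    obtain ⟨N, hN⟩ := hcau ε hε
    refine ⟨N, fun m hm => ?_⟩
    have h1 := hN N le_rfl m hm
    have h2 : 0 ≤ dist (g (p m).1) (g (p N).1) := dist_nonneg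
    simp only [D] at h1
    linarith
  obtain ⟨a, ha⟩ := cauchySeq_tendsto_of_complete hcx
  obtain ⟨b, hb⟩ := cauchySeq_tendsto_of_complete hcy
  refine ⟨a, b, ?_, ?_⟩
  · have h1 := (hgcont.tendsto a).comp (ha.comp (tendsto_add_atTop_nat 1))
    have h2 := (hFcont.tendsto (a, b)).comp (ha.prodMk_nhds hb)
    refine tendsto_nhds_unique h1 (h2.congr fun n => ?_)
    simp [hx, hcomm]
  · have h1 := (hgcont.tendsto b).comp (hb.comp (tendsto_add_atTop_nat 1))
    have h2 := (hFcont.tendsto (b, a)).comp (hb.prodMk_nhds ha)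
    refine tendsto_nhds_unique h1 (h2.congr fun n => ?_)
    simp [hy, hcomm]
end

section
/- Let (X,≤) be a partially ordered set with a metric d such that (X,d) is a complete metric space. Let F : X×X → X have the mixed g-monotone property, where g : X → X is continuous, commutes with F, and F(X×X) ⊆ g(X). Suppose there exists φ ∈ Φ such that for all x,y,u,v ∈ X with g(x) ≥ g(u) and g(y) ≤ g(v), d(F(x,y),F(u,v)) + d(F(y,x),F(v,u)) ≤ 2·φ((d(g(x),g(u)) + d(g(y),g(v)))/2). Assume either F is continuous or X satisfies Assumption (*), and that there exist x₀, y₀ ∈ X with g(x₀) ≤ F(x₀,y₀) and g(y₀) ≥ F(y₀,x₀). Additionally assume that for every pair of points (x̄,ȳ), (x*,y*) ∈ X×X there exists (u,v) ∈ X×X such that (F(u,v),F(v,u)) is comparable (in the product order on X×X) both to (F(x*,y*),F(y*,x*)) and to (F(x̄,ȳ),F(ȳ,x̄)). Then F and g have a unique coupled common fixed point: there exists a unique pair (z̄,w̄) ∈ X×X such that z̄ = g(z̄) = F(z̄,w̄) and w̄ = g(w̄) = F(w̄,z̄). -/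
open Filter Topology

namespace IsPhiFun

variable {φ : ℝ → ℝ}

/-- The value of a function in `Φ` at `0` may be reset to `0`. -/
lemma update_zero (hφ : IsPhiFun φ) : IsPhiFun (Function.update φ 0 0) := by
  refine ⟨fun t ht => ?_, fun t ht => ?_, fun t ht => ?_⟩
  · rcases ht.eq_or_lt with rfl | ht'
    · simp
    · rw [Function.update_of_ne ht'.ne']
      exact hφ.1 t ht
  · rw [Function.update_of_ne ht.ne']
    exact hφ.2.1 t ht
  · obtain ⟨L, hL, hlim⟩ := hφ.2.2 t ht
    refine ⟨L, hL, hlim.congr' ?_⟩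
    filter_upwards [self_mem_nhdsWithin] with x hx
    rw [Function.update_of_ne (ht.trans hx).ne']

/-- To the right of `t > 0`, a function in `Φ` is bounded away from `t`. -/
lemma exists_bound_right (hφ : IsPhiFun φ) {t : ℝ} (ht : 0 < t) :
    ∃ c < t, ∃ η > 0, ∀ r, t < r → r < t + η → φ r ≤ c := by
  obtain ⟨L, hL, hlim⟩ := hφ.2.2 t ht
  obtain ⟨c, hLc, hct⟩ := exists_between hL
  have hev : ∀ᶠ r in 𝓝[>] t, φ r < c := hlim.eventually (gt_mem_nhds hLc)
  obtain ⟨b, hb, hsub⟩ := mem_nhdsGT_iff_exists_Ioo_subset.1 hev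
  have htb : t < b := hb
  exact ⟨c, hct, b - t, sub_pos.2 htb, fun r h₁ h₂ => (hsub ⟨h₁, by linarith⟩).le⟩

lemma tendsto_zero_of_le (hφ : IsPhiFun φ) (hφ0 : φ 0 = 0) {a : ℕ → ℝ} (ha : ∀ n, 0 ≤ a n)
    (hle : ∀ n, a (n + 1) ≤ φ (a n)) : Tendsto a atTop (𝓝 0) := by
  have hanti : Antitone a := antitone_nat_of_succ_le fun n => (hle n).trans <| by
    rcases (ha n).eq_or_lt with h | h
    · rw [← h, hφ0]
    · exact (hφ.2.1 _ h).le
  have hbdd : BddBelow (Set.range a) := ⟨0, by rintro _ ⟨n, rfl⟩; exact ha n⟩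
  have hlim := tendsto_atTop_ciInf hanti hbdd
  set δ := ⨅ n, a n
  have hδa : ∀ n, δ ≤ a n := fun n => ciInf_le hbdd n
  rcases (le_ciInf ha : 0 ≤ δ).eq_or_lt with h | h
  · rwa [h]
  obtain ⟨c, hc, η, hη, hbound⟩ := hφ.exists_bound_right h
  obtain ⟨n, hn⟩ := (hlim.eventually (gt_mem_nhds (by linarith : δ < δ + η))).exists
  have hlt : δ < a n :=
    (hδa (n + 1)).trans_lt ((hle n).trans_lt (hφ.2.1 _ (h.trans_le (hδa n))))
  linarith [hδa (n + 1), hle n, hbound _ hlt hn]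

lemma eventually_le_of_le (hφ : IsPhiFun φ) {D : ℕ → ℕ → ℝ}
    (hself : ∀ n, D n n = 0) (htri : ∀ l m n, D l n ≤ D l m + D m n)
    (hsymm : ∀ m n, D m n = D n m)
    (hle : ∀ m n, m ≤ n → D (m + 1) (n + 1) ≤ φ (D m n))
    (hsucc : Tendsto (fun n => D n (n + 1)) atTop (𝓝 0)) {ε : ℝ} (hε : 0 < ε) :
    ∃ N, ∀ m n, N ≤ m → m ≤ n → D m n ≤ ε := by
  obtain ⟨c, hc, η, hη, hbound⟩ := hφ.exists_bound_right hε
  have hpos : 0 < min η ((ε - c) / 2) := lt_min hη (by linarith)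
  obtain ⟨N, hN⟩ := eventually_atTop.1 (hsucc.eventually (gt_mem_nhds hpos))
  refine ⟨N, fun m n hm hmn => ?_⟩
  induction n, hmn using Nat.le_induction with
  | base => rw [hself]; exact hε.le
  | succ n hmn ih =>
    by_contra! hgt
    have h₁ := (lt_min_iff.1 (hN n (hm.trans hmn))).1
    have h₂ := (lt_min_iff.1 (hN m hm)).2
    have h₃ := (lt_min_iff.1 (hN (n + 1) (by omega))).2
    have h₄ := hbound _ hgt (by linarith [htri m n (n + 1)])
    have h₅ := hle m (n + 1) (by omega)
    linarith [htri m (m + 1) (n + 1), htri (m + 1) (n + 1 + 1) (n + 1),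
      hsymm (n + 1) (n + 1 + 1)]

end IsPhiFun

/-- The mean of the coordinate distances, a metric on `X × X` equivalent to the usual one. -/
noncomputable def pairDist {X : Type*} [MetricSpace X] (p q : X × X) : ℝ :=
  (dist p.1 q.1 + dist p.2 q.2) / 2

section PairDist

variable {X : Type*} [MetricSpace X]

lemma pairDist_nonneg (p q : X × X) : 0 ≤ pairDist p q := by
  unfold pairDist
  positivity

lemma pairDist_self (p : X × X) : pairDist p p = 0 := by
  simp [pairDist]

lemma pairDist_comm (p q : X × X) : pairDist p q = pairDist q p := by
  simp [pairDist, dist_comm]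

lemma pairDist_triangle (p q r : X × X) : pairDist p r ≤ pairDist p q + pairDist q r := by
  unfold pairDist
  linarith [dist_triangle p.1 q.1 r.1, dist_triangle p.2 q.2 r.2]

lemma dist_le_two_mul_pairDist (p q : X × X) : dist p q ≤ 2 * pairDist p q := by
  rw [Prod.dist_eq, pairDist]
  exact max_le (by linarith [dist_nonneg (x := p.2) (y := q.2)])
    (by linarith [dist_nonneg (x := p.1) (y := q.1)])

lemma pairDist_le_dist (p q : X × X) : pairDist p q ≤ dist p q := by
  rw [Prod.dist_eq, pairDist]
  linarith [le_max_left (dist p.1 q.1) (dist p.2 q.2),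
    le_max_right (dist p.1 q.1) (dist p.2 q.2)]

lemma tendsto_dist_of_tendsto_pairDist {a b : ℕ → X × X}
    (h : Tendsto (fun n => pairDist (a n) (b n)) atTop (𝓝 0)) :
    Tendsto (fun n => dist (a n) (b n)) atTop (𝓝 0) :=
  squeeze_zero (fun _ => dist_nonneg) (fun _ => dist_le_two_mul_pairDist _ _)
    (by simpa using h.const_mul 2)

end PairDist

/-- `T` is `G`-monotone and a `φ`-contraction relative to `G` on comparable pairs. -/
structure IsPhiContraction {X : Type*} [MetricSpace X] [PartialOrder X] (φ : ℝ → ℝ)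
    (T G : X × X → X × X) : Prop where
  mono : ∀ p q, PairLe (G p) (G q) → PairLe (T p) (T q)
  pairDist_le : ∀ p q, PairLe (G p) (G q) → pairDist (T p) (T q) ≤ φ (pairDist (G p) (G q))

namespace IsPhiContraction

variable {X : Type*} [MetricSpace X] [PartialOrder X] {φ : ℝ → ℝ} {T G : X × X → X × X}

lemma pairLe_orbit (h : IsPhiContraction φ T G) {p q : ℕ → X × X}
    (hp : ∀ n, G (p (n + 1)) = T (p n)) (hq : ∀ n, G (q (n + 1)) = T (q n))
    (h0 : PairLe (G (p 0)) (G (q 0))) (n : ℕ) : PairLe (G (p n)) (G (q n)) := by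
  induction n with
  | zero => exact h0
  | succ n ih =>
    rw [hp, hq]
    exact h.mono _ _ ih

lemma tendsto_pairDist_orbit (h : IsPhiContraction φ T G) (hφ : IsPhiFun φ) (hφ0 : φ 0 = 0)
    {p q : ℕ → X × X}
    (hp : ∀ n, G (p (n + 1)) = T (p n)) (hq : ∀ n, G (q (n + 1)) = T (q n))
    (h0 : PairLe (G (p 0)) (G (q 0))) :
    Tendsto (fun n => pairDist (G (p n)) (G (q n))) atTop (𝓝 0) := by
  refine hφ.tendsto_zero_of_le hφ0 (fun _ => pairDist_nonneg _ _) fun n => ?_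
  rw [hp, hq]
  exact h.pairDist_le _ _ (h.pairLe_orbit hp hq h0 n)

lemma tendsto_dist_orbit_of_comparable (h : IsPhiContraction φ T G) (hφ : IsPhiFun φ)
    (hφ0 : φ 0 = 0) {p q : ℕ → X × X}
    (hp : ∀ n, G (p (n + 1)) = T (p n)) (hq : ∀ n, G (q (n + 1)) = T (q n))
    (h0 : PairComparable (T (p 0)) (T (q 0))) :
    Tendsto (fun n => dist (G (p n)) (G (q n))) atTop (𝓝 0) := by
  rw [← hp 0, ← hq 0] at h0
  refine (tendsto_add_atTop_iff_nat 1).1 ?_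
  rcases h0 with h0 | h0
  · exact tendsto_dist_of_tendsto_pairDist (a := fun n => G (p (n + 1)))
      (b := fun n => G (q (n + 1)))
      (h.tendsto_pairDist_orbit hφ hφ0 (fun n => hp (n + 1)) (fun n => hq (n + 1)) h0)
  · simp_rw [dist_comm (G (p _))]
    exact tendsto_dist_of_tendsto_pairDist (a := fun n => G (q (n + 1)))
      (b := fun n => G (p (n + 1)))
      (h.tendsto_pairDist_orbit hφ hφ0 (fun n => hq (n + 1)) (fun n => hp (n + 1)) h0)

lemma pairLe_orbit_of_le (h : IsPhiContraction φ T G) {p : ℕ → X × X}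
    (hp : ∀ n, G (p (n + 1)) = T (p n)) (h0 : PairLe (G (p 0)) (T (p 0))) :
    (Monotone fun n => (G (p n)).1) ∧ Antitone fun n => (G (p n)).2 := by
  have hstep := h.pairLe_orbit (q := fun n => p (n + 1)) hp (fun n => hp (n + 1)) (by rwa [hp 0])
  exact ⟨monotone_nat_of_le_succ fun n => (hstep n).1, antitone_nat_of_succ_le fun n => (hstep n).2⟩

lemma cauchySeq_orbit (h : IsPhiContraction φ T G) (hφ : IsPhiFun φ) (hφ0 : φ 0 = 0)
    {p : ℕ → X × X} (hp : ∀ n, G (p (n + 1)) = T (p n)) (h0 : PairLe (G (p 0)) (T (p 0))) :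
    CauchySeq fun n => G (p n) := by
  obtain ⟨hmono, hanti⟩ := h.pairLe_orbit_of_le hp h0
  refine Metric.cauchySeq_iff'.2 fun ε hε => ?_
  obtain ⟨N, hN⟩ := hφ.eventually_le_of_le (D := fun m n => pairDist (G (p m)) (G (p n)))
    (fun _ => pairDist_self _) (fun _ _ _ => pairDist_triangle _ _ _)
    (fun _ _ => pairDist_comm _ _)
    (fun m n hmn => by
      rw [hp, hp]
      exact h.pairDist_le _ _ ⟨hmono hmn, hanti hmn⟩)
    (h.tendsto_pairDist_orbit hφ hφ0 (q := fun n => p (n + 1)) hp (fun n => hp (n + 1))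
      (by rwa [hp 0]))
    (by linarith : 0 < ε / 3)
  refine ⟨N, fun n hn => ?_⟩
  rw [dist_comm]
  linarith [dist_le_two_mul_pairDist (G (p N)) (G (p n)), hN N n le_rfl hn]

/-- If the images of `T` are pairwise comparable to a third one, `T` and `G` have a unique common
fixed point: every `G`-orbit of `T` has the same limit, hence `G` fixes that limit, and then so
does `T`. -/
theorem existsUnique_fixed [CompleteSpace X] (h : IsPhiContraction φ T G) (hφ : IsPhiFun φ)
    (hφ0 : φ 0 = 0) (hG : Continuous G) (hcomm : ∀ p, G (T p) = T (G p))
    (hrange : ∀ p, ∃ q, G q = T p) (hT : Continuous T ∨ AssumptionStar X) {p₀ : X × X}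
    (h0 : PairLe (G p₀) (T p₀))
    (hcomp : ∀ p q, ∃ w, PairComparable (T w) (T q) ∧ PairComparable (T w) (T p)) :
    ∃! p, G p = p ∧ T p = p := by
  choose s hs using hrange
  have horbit : ∀ q n, G (s^[n + 1] q) = T (s^[n] q) := fun q n => by
    rw [Function.iterate_succ_apply', hs]
  set p : ℕ → X × X := fun n => s^[n] p₀
  have hp : ∀ n, G (p (n + 1)) = T (p n) := horbit p₀
  obtain ⟨z, hz⟩ := cauchySeq_tendsto_of_complete (h.cauchySeq_orbit hφ hφ0 hp h0)
  have hall : ∀ q : ℕ → X × X, (∀ n, G (q (n + 1)) = T (q n)) →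
      Tendsto (fun n => G (q n)) atTop (𝓝 z) := fun q hq => by
    obtain ⟨w, hwq, hwp⟩ := hcomp (p 0) (q 0)
    have hw : ∀ n, G (s^[n + 1] w) = T (s^[n] w) := horbit w
    have hpw := h.tendsto_dist_orbit_of_comparable hφ hφ0 (p := fun n => s^[n] w) hw hp hwp
    have hwq := h.tendsto_dist_orbit_of_comparable hφ hφ0 (p := fun n => s^[n] w) hw hq hwq
    simp_rw [dist_comm (G (s^[_] w)) (G (p _))] at hpw
    exact (hz.congr_dist hpw).congr_dist hwq
  have hGG : Tendsto (fun n => G (G (p n))) atTop (𝓝 z) :=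
    hall (fun n => G (p n)) fun n => by rw [hp, hcomm]
  have hGz : G z = z := tendsto_nhds_unique ((hG.tendsto z).comp hz) hGG
  have hTz : T z = z := by
    rcases hT with hT | ⟨hup, hdown⟩
    · refine tendsto_nhds_unique ((hT.tendsto z).comp hz)
        (((tendsto_add_atTop_iff_nat 1).2 hGG).congr fun n => ?_)
      rw [hp, hcomm, Function.comp_apply]
    · obtain ⟨hmono, hanti⟩ := h.pairLe_orbit_of_le hp h0
      have hle : ∀ n, PairLe (G (p n)) (G z) := fun n => by
        rw [hGz]
        exact ⟨hup _ _ hmono ((continuous_fst.tendsto z).comp hz) n,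
          hdown _ _ hanti ((continuous_snd.tendsto z).comp hz) n⟩
      have hnear : Tendsto (fun n => pairDist (G (p n)) z) atTop (𝓝 0) :=
        squeeze_zero (fun _ => pairDist_nonneg _ _) (fun _ => pairDist_le_dist _ _)
          (tendsto_iff_dist_tendsto_zero.1 hz)
      have hlim : Tendsto (fun n => pairDist (T (p n)) (T z)) atTop (𝓝 0) := by
        refine squeeze_zero (fun _ => pairDist_nonneg _ _) (fun n => ?_) hnear
        refine (h.pairDist_le _ _ (hle n)).trans ?_
        rw [hGz]
        rcases (pairDist_nonneg (G (p n)) z).eq_or_lt with h' | h'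
        · rw [← h', hφ0]
        · exact (hφ.2.1 _ h').le
      have hTp : Tendsto (fun n => T (p n)) atTop (𝓝 (T z)) :=
        tendsto_iff_dist_tendsto_zero.2 (tendsto_dist_of_tendsto_pairDist hlim)
      refine tendsto_nhds_unique hTp (((tendsto_add_atTop_iff_nat 1).2 hz).congr hp)
  refine ⟨z, ⟨hGz, hTz⟩, fun q ⟨hGq, hTq⟩ => ?_⟩
  have hq := hall (fun _ => q) fun _ => hGq.trans hTq.symm
  rw [hGq] at hq
  exact tendsto_nhds_unique tendsto_const_nhds hq

end IsPhiContraction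

lemma isPhiContraction_of_mixedGMonotone {X : Type*} [MetricSpace X] [PartialOrder X]
    {F : X → X → X} {g : X → X} (hmono : MixedGMonotone g F) {φ : ℝ → ℝ}
    (hcontr : ∀ x y u v : X, g u ≤ g x → g y ≤ g v →
      dist (F x y) (F u v) + dist (F y x) (F v u) ≤
        2 * φ ((dist (g x) (g u) + dist (g y) (g v)) / 2)) :
    IsPhiContraction (Function.update φ 0 0) (fun p : X × X => (F p.1 p.2, F p.2 p.1))
      (Prod.map g g) := by
  have hle : ∀ p q : X × X, PairLe (Prod.map g g p) (Prod.map g g q) →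
      PairLe (F p.1 p.2, F p.2 p.1) (F q.1 q.2, F q.2 q.1) := fun p q h =>
    ⟨(hmono.1 _ _ _ h.1).trans (hmono.2 _ _ _ h.2), (hmono.1 _ _ _ h.2).trans (hmono.2 _ _ _ h.1)⟩
  refine ⟨hle, fun p q h => ?_⟩
  rcases (pairDist_nonneg (Prod.map g g p) (Prod.map g g q)).eq_or_lt with h0 | hpos
  · have heq : Prod.map g g p = Prod.map g g q := dist_le_zero.1 <| by
      linarith [dist_le_two_mul_pairDist (Prod.map g g p) (Prod.map g g q)]
    have h₁ := hle p q h
    have h₂ := hle q p (by rw [heq]; exact ⟨le_rfl, le_rfl⟩)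
    have hT : (F p.1 p.2, F p.2 p.1) = (F q.1 q.2, F q.2 q.1) :=
      Prod.ext (le_antisymm h₁.1 h₂.1) (le_antisymm h₂.2 h₁.2)
    simp only [hT, ← h0, pairDist_self, Function.update_self, le_refl]
  · rw [Function.update_of_ne hpos.ne', pairDist_comm, pairDist_comm (Prod.map g g p)]
    have := hcontr q.1 q.2 p.1 p.2 h.1 h.2
    simp only [pairDist, Prod.map_fst, Prod.map_snd]
    linarith

theorem unique_coupled_common_fixed_point_of_phi_contraction
    {X : Type*} [MetricSpace X] [CompleteSpace X] [PartialOrder X]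
    (F : X → X → X) (g : X → X)
    (hmono : MixedGMonotone g F)
    (hgcont : Continuous g)
    (hcomm : ∀ x y : X, g (F x y) = F (g x) (g y))
    (hrange : ∀ x y : X, F x y ∈ Set.range g)
    (φ : ℝ → ℝ) (hφ : IsPhiFun φ)
    (hcontr : ∀ x y u v : X, g u ≤ g x → g y ≤ g v →
      dist (F x y) (F u v) + dist (F y x) (F v u) ≤
        2 * φ ((dist (g x) (g u) + dist (g y) (g v)) / 2))
    (hcont_or_star : Continuous (Function.uncurry F) ∨ AssumptionStar X)
    (x₀ y₀ : X)
    (h0 : g x₀ ≤ F x₀ y₀ ∧ F y₀ x₀ ≤ g y₀)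
    (hcomp : ∀ x₁ y₁ x₂ y₂ : X, ∃ u v : X,
      PairComparable (F u v, F v u) (F x₂ y₂, F y₂ x₂) ∧
      PairComparable (F u v, F v u) (F x₁ y₁, F y₁ x₁)) :
    ∃! p : X × X, p.1 = g p.1 ∧ p.1 = F p.1 p.2 ∧ p.2 = g p.2 ∧ p.2 = F p.2 p.1 := by
  have hcontraction := isPhiContraction_of_mixedGMonotone hmono hcontr
  have hfixed := hcontraction.existsUnique_fixed hφ.update_zero (Function.update_self _ _ _)
    (hgcont.prodMap hgcont) (fun p => Prod.ext (hcomm _ _) (hcomm _ _))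
    (fun p => by
      obtain ⟨a, ha⟩ := hrange p.1 p.2
      obtain ⟨b, hb⟩ := hrange p.2 p.1
      exact ⟨(a, b), Prod.ext ha hb⟩)
    (hcont_or_star.imp_left fun hF => hF.prodMk (hF.comp continuous_swap))
    (p₀ := (x₀, y₀)) h0
    (fun p q => by
      obtain ⟨u, v, huv⟩ := hcomp p.1 p.2 q.1 q.2
      exact ⟨(u, v), huv⟩)
  refine (existsUnique_congr fun p => ?_).1 hfixed
  simp only [Prod.ext_iff, Prod.map_fst, Prod.map_snd]
  grind
end

section
/- Under the hypotheses of the uniqueness theorem (complete partially ordered metric space (X,d,≤); F : X×X → X mixed g-monotone; g continuous, commuting with F, with F(X×X) ⊆ g(X); φ ∈ Φ with d(F(x,y),F(u,v)) + d(F(y,x),F(v,u)) ≤ 2·φ((d(g(x),g(u)) + d(g(y),g(v)))/2) whenever g(x) ≥ g(u) and g(y) ≤ g(v); either F continuous or X satisfying Assumption (*); existence of x₀, y₀ with g(x₀) ≤ F(x₀,y₀) and g(y₀) ≥ F(y₀,x₀); and for all (x̄,ȳ), (x*,y*) ∈ X×X there exists (u,v) ∈ X×X with (F(u,v),F(v,u))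 comparable in the product order to both (F(x*,y*),F(y*,x*)) and (F(x̄,ȳ),F(ȳ,x̄))), any two coupled coincidence points (x̄,ȳ) and (x*,y*) of F and g satisfy g(x̄) = g(x*) and g(ȳ) = g(y*). -/
open Filter Topology

theorem IsPhiFun.tendsto_zero_of_le_s3 {φ : ℝ → ℝ} (hφ : IsPhiFun φ) {δ : ℕ → ℝ}
    (hδ : ∀ n, 0 ≤ δ n) (hpos : ∀ n, 0 < δ n → δ (n + 1) ≤ φ (δ n))
    (hzero : ∀ n, δ n = 0 → δ (n + 1) = 0) : Tendsto δ atTop (𝓝 0) := by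
  obtain ⟨-, hlt, hlim⟩ := hφ
  have hanti : Antitone δ := antitone_nat_of_succ_le fun n => by
    rcases (hδ n).eq_or_lt with h | h
    · rw [hzero n h.symm, ← h]
    · exact (hpos n h).trans (hlt _ h).le
  have hbdd : BddBelow (Set.range δ) := ⟨0, Set.forall_mem_range.2 hδ⟩
  have htend : Tendsto δ atTop (𝓝 (⨅ n, δ n)) := tendsto_atTop_ciInf hanti hbdd
  have hge : ∀ n, (⨅ n, δ n) ≤ δ n := ciInf_le hbdd
  generalize (⨅ n, δ n) = l at htend hge
  rcases (ge_of_tendsto' htend hδ).eq_or_lt with h | hl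
  · rwa [h]
  have hgt : ∀ n, l < δ n := fun n =>
    (hge (n + 1)).trans_lt <|
      (hpos n (hl.trans_le (hge n))).trans_lt (hlt _ (hl.trans_le (hge n)))
  obtain ⟨m, hml, hm⟩ := hlim l hl
  have hφδ : Tendsto (fun n => φ (δ n)) atTop (𝓝 m) :=
    hm.comp (tendsto_nhdsWithin_iff.2 ⟨htend, Eventually.of_forall hgt⟩)
  have hle : l ≤ m := le_of_tendsto_of_tendsto' ((tendsto_add_atTop_iff_nat 1).2 htend) hφδ
    fun n => hpos n (hl.trans (hgt n))
  exact absurd hml hle.not_gt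

theorem MixedGMonotone.pairLe {X : Type*} [Preorder X] {g : X → X} {F : X → X → X}
    (h : MixedGMonotone g F) {a b x y : X} (hle : PairLe (g a, g b) (g x, g y)) :
    PairLe (F a b, F b a) (F x y, F y x) :=
  ⟨(h.1 b a x hle.1).trans (h.2 x y b hle.2), (h.1 x y b hle.2).trans (h.2 b a x hle.1)⟩

theorem MixedGMonotone.pairComparable {X : Type*} [Preorder X] {g : X → X} {F : X → X → X}
    (h : MixedGMonotone g F) {a b x y : X} (hc : PairComparable (g a, g b) (g x, g y)) :
    PairComparable (F a b, F b a) (F x y, F y x) :=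
  hc.imp h.pairLe h.pairLe

theorem MixedGMonotone.eq_of_eq {X : Type*} [PartialOrder X] {g : X → X} {F : X → X → X}
    (h : MixedGMonotone g F) {a b x y : X} (hx : g a = g x) (hy : g b = g y) :
    F a b = F x y :=
  le_antisymm (h.pairLe ⟨hx.le, hy.ge⟩).1 (h.pairLe ⟨hx.ge, hy.le⟩).1

/-- The Picard-type iterates of `(u, v)` converge to the `g`-image of any coupled coincidence
point comparable to their starting pair. -/
theorem tendsto_g_iterate_of_pairComparable {X : Type*} [MetricSpace X] [PartialOrder X]
    {F : X → X → X} {g : X → X} (hmono : MixedGMonotone g F) {φ : ℝ → ℝ} (hφ : IsPhiFun φ)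
    (hcontr : ∀ x y u v : X, g u ≤ g x → g y ≤ g v →
      dist (F x y) (F u v) + dist (F y x) (F v u) ≤
        2 * φ ((dist (g x) (g u) + dist (g y) (g v)) / 2))
    {u v : ℕ → X} (hu : ∀ n, g (u (n + 1)) = F (u n) (v n))
    (hv : ∀ n, g (v (n + 1)) = F (v n) (u n)) {x y : X}
    (hx : F x y = g x) (hy : F y x = g y) (h0 : PairComparable (g (u 0), g (v 0)) (g x, g y)) :
    Tendsto (fun n => g (u n)) atTop (𝓝 (g x)) ∧ Tendsto (fun n => g (v n)) atTop (𝓝 (g y)) := by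
  have hc : ∀ n, PairComparable (g (u n), g (v n)) (g x, g y) := fun n => by
    induction n with
    | zero => exact h0
    | succ n ih => simpa only [hu, hv, hx, hy] using hmono.pairComparable ih
  have hδ : Tendsto (fun n => (dist (g (u n)) (g x) + dist (g (v n)) (g y)) / 2) atTop (𝓝 0) := by
    refine hφ.tendsto_zero_of_le_s3 (fun n => by positivity) (fun n _ => ?_) (fun n hn => ?_)
    · rw [hu, hv, div_le_iff₀' two_pos]
      rcases hc n with h | h
      · have := hcontr x y (u n) (v n) h.1 h.2
        rw [hx, hy] at this
        simpa only [dist_comm] using this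
      · have := hcontr (u n) (v n) x y h.1 h.2
        rwa [hx, hy] at this
    · have h1 := dist_nonneg (x := g (u n)) (y := g x)
      have h2 := dist_nonneg (x := g (v n)) (y := g y)
      have hxn : g (u n) = g x := dist_eq_zero.1 (by linarith)
      have hyn : g (v n) = g y := dist_eq_zero.1 (by linarith)
      rw [hu, hv, hmono.eq_of_eq hxn hyn, hmono.eq_of_eq hyn hxn, hx, hy]
      simp
  have hsum := hδ.const_mul 2
  rw [mul_zero] at hsum
  constructor <;> rw [tendsto_iff_dist_tendsto_zero] <;>
    refine squeeze_zero (fun n => dist_nonneg) (fun n => ?_) hsum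
  · linarith [dist_nonneg (x := g (v n)) (y := g y)]
  · linarith [dist_nonneg (x := g (u n)) (y := g x)]

theorem g_images_of_coupled_coincidence_points_agree
    {X : Type*} [MetricSpace X] [CompleteSpace X] [PartialOrder X]
    (F : X → X → X) (g : X → X)
    (hmono : MixedGMonotone g F)
    (hgcont : Continuous g)
    (hcomm : ∀ x y : X, g (F x y) = F (g x) (g y))
    (hrange : ∀ x y : X, F x y ∈ Set.range g)
    (φ : ℝ → ℝ) (hφ : IsPhiFun φ)
    (hcontr : ∀ x y u v : X, g u ≤ g x → g y ≤ g v →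
      dist (F x y) (F u v) + dist (F y x) (F v u) ≤
        2 * φ ((dist (g x) (g u) + dist (g y) (g v)) / 2))
    (hcont_or_star : Continuous (Function.uncurry F) ∨ AssumptionStar X)
    (x₀ y₀ : X)
    (h0 : g x₀ ≤ F x₀ y₀ ∧ F y₀ x₀ ≤ g y₀)
    (hcomp : ∀ x₁ y₁ x₂ y₂ : X, ∃ u v : X,
      PairComparable (F u v, F v u) (F x₂ y₂, F y₂ x₂) ∧
      PairComparable (F u v, F v u) (F x₁ y₁, F y₁ x₁)) :
    ∀ xb yb xs ys : X,
      F xb yb = g xb → F yb xb = g yb →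
      F xs ys = g xs → F ys xs = g ys →
      g xb = g xs ∧ g yb = g ys := by
  intro xb yb xs ys hxb hyb hxs hys
  choose G hG using hrange
  obtain ⟨u, v, hs, hb⟩ := hcomp xb yb xs ys
  let s : ℕ → X × X := fun n => (fun p => (G p.1 p.2, G p.2 p.1))^[n] (G u v, G v u)
  have hsucc : ∀ n, s (n + 1) = (G (s n).1 (s n).2, G (s n).2 (s n).1) := fun n =>
    Function.iterate_succ_apply' _ _ _
  have hu : ∀ n, g (s (n + 1)).1 = F (s n).1 (s n).2 := fun n => by rw [hsucc, hG]
  have hv : ∀ n, g (s (n + 1)).2 = F (s n).2 (s n).1 := fun n => by rw [hsucc, hG]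
  have key : ∀ {x y : X}, F x y = g x → F y x = g y →
      PairComparable (F u v, F v u) (F x y, F y x) →
      Tendsto (fun n => g (s n).1) atTop (𝓝 (g x)) ∧
        Tendsto (fun n => g (s n).2) atTop (𝓝 (g y)) := fun {x y} hx hy h =>
    tendsto_g_iterate_of_pairComparable (u := fun n => (s n).1) (v := fun n => (s n).2)
      hmono hφ hcontr hu hv hx hy (by
        change PairComparable (g (G u v), g (G v u)) (g x, g y)
        rwa [hG, hG, ← hx, ← hy])
  have hb' := key hxb hyb hb
  have hs' := key hxs hys hs
  exact ⟨tendsto_nhds_unique hb'.1 hs'.1, tendsto_nhds_unique hb'.2 hs'.2⟩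
end

section
/- Let (X,≤) be a partially ordered set with a metric d such that (X,d) is a complete metric space. Let F : X×X → X have the mixed g-monotone property, where g : X → X is continuous, commutes with F, and F(X×X) ⊆ g(X). Suppose there exists k ∈ [0,1) such that for all x,y,u,v ∈ X with g(x) ≥ g(u) and g(y) ≤ g(v), d(F(x,y),F(u,v)) + d(F(y,x),F(v,u)) ≤ k·[d(g(x),g(u)) + d(g(y),g(v))]. Assume either F is continuous or X satisfies Assumption (*), that there exist x₀, y₀ ∈ X with g(x₀) ≤ F(x₀,y₀) and g(y₀) ≥ F(y₀,x₀), and that for every pair of points (x̄,ȳ), (x*,y*) ∈ X×X there exists (u,v) ∈ X×X such that (F(u,v),F(v,u)) is comparable in the product order both to (F(x*,y*),F(y*,x*)) and to (F(x̄,ȳ),F(ȳ,x̄)). Then F and g have a unique coupled common fixed point: there exists a unique pair (z̄,w̄) ∈ X×X such that z̄ = g(z̄) = F(z̄,w̄) and w̄ = g(w̄) = F(w̄,z̄). -/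
open Filter Topology

/-- The pair of sequences `(u, v)` satisfies the coupled Picard recursion
`g (u (n + 1)) = F (u n) (v n)` and `g (v (n + 1)) = F (v n) (u n)`. -/
def IsCoupledPicard {X : Type*} (g : X → X) (F : X → X → X) (u v : ℕ → X) : Prop :=
  ∀ n, g (u (n + 1)) = F (u n) (v n) ∧ g (v (n + 1)) = F (v n) (u n)

namespace IsCoupledPicard

variable {X : Type*} {g : X → X} {F : X → X → X} {u v u' v' : ℕ → X}

lemma exists_of_range (hrange : ∀ x y : X, F x y ∈ Set.range g) (x y : X) :
    ∃ u v : ℕ → X, u 0 = x ∧ v 0 = y ∧ IsCoupledPicard g F u v := by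
  choose h hh using hrange
  let s : ℕ → X × X := fun n => (fun p : X × X => (h p.1 p.2, h p.2 p.1))^[n] (x, y)
  refine ⟨fun n => (s n).1, fun n => (s n).2, rfl, rfl, fun n => ?_⟩
  simp only [s, Function.iterate_succ_apply', hh, and_self]

lemma shift (h : IsCoupledPicard g F u v) :
    IsCoupledPicard g F (fun n => u (n + 1)) (fun n => v (n + 1)) :=
  fun n => h (n + 1)

lemma map (h : IsCoupledPicard g F u v) (hcomm : ∀ x y : X, g (F x y) = F (g x) (g y)) :
    IsCoupledPicard g F (fun n => g (u n)) (fun n => g (v n)) := fun n => by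
  simp only [(h n).1, (h n).2, hcomm, and_self]

lemma pairLe [Preorder X] (hmono : MixedGMonotone g F) (h : IsCoupledPicard g F u v)
    (h' : IsCoupledPicard g F u' v') (h0 : PairLe (g (u 0), g (v 0)) (g (u' 0), g (v' 0)))
    (n : ℕ) : PairLe (g (u n), g (v n)) (g (u' n), g (v' n)) := by
  induction n with
  | zero => exact h0
  | succ n ih =>
    obtain ⟨h1, h2⟩ := ih
    simp only [PairLe, (h n).1, (h n).2, (h' n).1, (h' n).2]
    exact ⟨(hmono.1 _ _ _ h1).trans (hmono.2 _ _ _ h2),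
      (hmono.1 _ _ _ h2).trans (hmono.2 _ _ _ h1)⟩

variable [MetricSpace X] [Preorder X] {k : ℝ}

lemma dist_le_geometric (hmono : MixedGMonotone g F) (hk0 : 0 ≤ k)
    (hcontr : ∀ x y u v : X, g u ≤ g x → g y ≤ g v →
      dist (F x y) (F u v) + dist (F y x) (F v u) ≤
        k * (dist (g x) (g u) + dist (g y) (g v)))
    (h : IsCoupledPicard g F u v) (h' : IsCoupledPicard g F u' v')
    (h0 : PairLe (g (u 0), g (v 0)) (g (u' 0), g (v' 0))) (n : ℕ) :
    dist (g (u' n)) (g (u n)) + dist (g (v' n)) (g (v n)) ≤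
      (dist (g (u' 0)) (g (u 0)) + dist (g (v' 0)) (g (v 0))) * k ^ n := by
  induction n with
  | zero => simp
  | succ n ih =>
    obtain ⟨h1, h2⟩ := pairLe hmono h h' h0 n
    rw [(h n).1, (h n).2, (h' n).1, (h' n).2]
    calc _ ≤ _ := hcontr _ _ _ _ h1 h2
      _ ≤ _ := mul_le_mul_of_nonneg_left ih hk0
      _ = _ := by ring

lemma tendsto_of_pairLe (hmono : MixedGMonotone g F) (hk0 : 0 ≤ k) (hk1 : k < 1)
    (hcontr : ∀ x y u v : X, g u ≤ g x → g y ≤ g v →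
      dist (F x y) (F u v) + dist (F y x) (F v u) ≤
        k * (dist (g x) (g u) + dist (g y) (g v)))
    (h : IsCoupledPicard g F u v) (h' : IsCoupledPicard g F u' v')
    (h0 : PairLe (g (u 0), g (v 0)) (g (u' 0), g (v' 0))) :
    Tendsto (fun n => dist (g (u' n)) (g (u n))) atTop (𝓝 0) ∧
      Tendsto (fun n => dist (g (v' n)) (g (v n))) atTop (𝓝 0) := by
  have hgeo := dist_le_geometric hmono hk0 hcontr h h' h0
  have hlim := (tendsto_pow_atTop_nhds_zero_of_lt_one hk0 hk1).const_mul
    (dist (g (u' 0)) (g (u 0)) + dist (g (v' 0)) (g (v 0)))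
  rw [mul_zero] at hlim
  exact ⟨squeeze_zero (fun _ => dist_nonneg)
      (fun n => (le_add_of_nonneg_right dist_nonneg).trans (hgeo n)) hlim,
    squeeze_zero (fun _ => dist_nonneg)
      (fun n => (le_add_of_nonneg_left dist_nonneg).trans (hgeo n)) hlim⟩

lemma tendsto_of_pairComparable (hmono : MixedGMonotone g F) (hk0 : 0 ≤ k) (hk1 : k < 1)
    (hcontr : ∀ x y u v : X, g u ≤ g x → g y ≤ g v →
      dist (F x y) (F u v) + dist (F y x) (F v u) ≤
        k * (dist (g x) (g u) + dist (g y) (g v)))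
    (h : IsCoupledPicard g F u v) (h' : IsCoupledPicard g F u' v')
    (h0 : PairComparable (F (u 0) (v 0), F (v 0) (u 0)) (F (u' 0) (v' 0), F (v' 0) (u' 0))) :
    Tendsto (fun n => dist (g (u (n + 1))) (g (u' (n + 1)))) atTop (𝓝 0) ∧
      Tendsto (fun n => dist (g (v (n + 1))) (g (v' (n + 1)))) atTop (𝓝 0) := by
  rw [← (h 0).1, ← (h 0).2, ← (h' 0).1, ← (h' 0).2] at h0
  rcases h0 with h0 | h0
  · simpa only [dist_comm] using tendsto_of_pairLe hmono hk0 hk1 hcontr h.shift h'.shift h0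
  · exact tendsto_of_pairLe hmono hk0 hk1 hcontr h'.shift h.shift h0

/-- If any two values of the coupled map have a common comparable value, then all coupled
Picard sequences have the same limit. -/
lemma tendsto_of_tendsto (hmono : MixedGMonotone g F) (hk0 : 0 ≤ k) (hk1 : k < 1)
    (hrange : ∀ x y : X, F x y ∈ Set.range g)
    (hcontr : ∀ x y u v : X, g u ≤ g x → g y ≤ g v →
      dist (F x y) (F u v) + dist (F y x) (F v u) ≤
        k * (dist (g x) (g u) + dist (g y) (g v)))
    (hcomp : ∀ x₁ y₁ x₂ y₂ : X, ∃ u v : X,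
      PairComparable (F u v, F v u) (F x₂ y₂, F y₂ x₂) ∧
      PairComparable (F u v, F v u) (F x₁ y₁, F y₁ x₁))
    (h : IsCoupledPicard g F u v) (h' : IsCoupledPicard g F u' v') {x y : X}
    (hx : Tendsto (fun n => g (u n)) atTop (𝓝 x)) (hy : Tendsto (fun n => g (v n)) atTop (𝓝 y)) :
    Tendsto (fun n => g (u' n)) atTop (𝓝 x) ∧ Tendsto (fun n => g (v' n)) atTop (𝓝 y) := by
  obtain ⟨a, b, h2, h1⟩ := hcomp (u 0) (v 0) (u' 0) (v' 0)
  obtain ⟨p, q, rfl, rfl, hpq⟩ := exists_of_range hrange a b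
  obtain ⟨t1, s1⟩ := tendsto_of_pairComparable hmono hk0 hk1 hcontr hpq h h1
  obtain ⟨t2, s2⟩ := tendsto_of_pairComparable hmono hk0 hk1 hcontr hpq h' h2
  rw [← tendsto_add_atTop_iff_nat 1] at hx hy
  constructor
  · rw [← tendsto_add_atTop_iff_nat 1]
    exact (((tendsto_iff_of_dist t1).2 hx).congr_dist t2)
  · rw [← tendsto_add_atTop_iff_nat 1]
    exact (((tendsto_iff_of_dist s1).2 hy).congr_dist s2)

end IsCoupledPicard

theorem unique_coupled_common_fixed_point_of_linear_contraction
    {X : Type*} [MetricSpace X] [CompleteSpace X] [PartialOrder X]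
    (F : X → X → X) (g : X → X)
    (hmono : MixedGMonotone g F)
    (hgcont : Continuous g)
    (hcomm : ∀ x y : X, g (F x y) = F (g x) (g y))
    (hrange : ∀ x y : X, F x y ∈ Set.range g)
    (k : ℝ) (hk0 : 0 ≤ k) (hk1 : k < 1)
    (hcontr : ∀ x y u v : X, g u ≤ g x → g y ≤ g v →
      dist (F x y) (F u v) + dist (F y x) (F v u) ≤
        k * (dist (g x) (g u) + dist (g y) (g v)))
    (hcont_or_star : Continuous (Function.uncurry F) ∨ AssumptionStar X)
    (x₀ y₀ : X)
    (h0 : g x₀ ≤ F x₀ y₀ ∧ F y₀ x₀ ≤ g y₀)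
    (hcomp : ∀ x₁ y₁ x₂ y₂ : X, ∃ u v : X,
      PairComparable (F u v, F v u) (F x₂ y₂, F y₂ x₂) ∧
      PairComparable (F u v, F v u) (F x₁ y₁, F y₁ x₁)) :
    ∃! p : X × X, p.1 = g p.1 ∧ p.1 = F p.1 p.2 ∧ p.2 = g p.2 ∧ p.2 = F p.2 p.1 := by
  obtain ⟨u, v, rfl, rfl, huv⟩ := IsCoupledPicard.exists_of_range hrange x₀ y₀
  rw [← (huv 0).1, ← (huv 0).2] at h0
  have hle := IsCoupledPicard.pairLe hmono huv huv.shift h0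
  have hgeo := IsCoupledPicard.dist_le_geometric hmono hk0 hcontr huv huv.shift h0
  obtain ⟨x, hx⟩ := cauchySeq_tendsto_of_complete <|
    cauchySeq_of_le_geometric (f := fun n => g (u n)) k _ hk1 fun n => by
      rw [dist_comm]
      exact (le_add_of_nonneg_right dist_nonneg).trans (hgeo n)
  obtain ⟨y, hy⟩ := cauchySeq_tendsto_of_complete <|
    cauchySeq_of_le_geometric (f := fun n => g (v n)) k _ hk1 fun n => by
      rw [dist_comm]
      exact (le_add_of_nonneg_left dist_nonneg).trans (hgeo n)
  have hlim {p q : ℕ → X} (hpq : IsCoupledPicard g F p q) :=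
    IsCoupledPicard.tendsto_of_tendsto hmono hk0 hk1 hrange hcontr hcomp huv hpq hx hy
  obtain ⟨hgx, hgy⟩ := hlim (huv.map hcomm)
  have ex : g x = x := tendsto_nhds_unique ((hgcont.tendsto x).comp hx) hgx
  have ey : g y = y := tendsto_nhds_unique ((hgcont.tendsto y).comp hy) hgy
  have hF : F x y = x ∧ F y x = y := by
    rcases hcont_or_star with hF | ⟨hinc, hdec⟩
    · have hmap := huv.map hcomm
      constructor
      · refine tendsto_nhds_unique ((hF.tendsto (x, y)).comp (hx.prodMk_nhds hy)) ?_
        exact ((tendsto_add_atTop_iff_nat 1).2 hgx).congr fun n => (hmap n).1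
      · refine tendsto_nhds_unique ((hF.tendsto (y, x)).comp (hy.prodMk_nhds hx)) ?_
        exact ((tendsto_add_atTop_iff_nat 1).2 hgy).congr fun n => (hmap n).2
    · have hux := hinc _ x (monotone_nat_of_le_succ fun n => (hle n).1) hx
      have hvy := hdec _ y (antitone_nat_of_succ_le fun n => (hle n).2) hy
      have hb (n : ℕ) : dist (F x y) (g (u (n + 1))) + dist (F y x) (g (v (n + 1))) ≤
          k * (dist x (g (u n)) + dist y (g (v n))) := by
        have := hcontr x y (u n) (v n) (by rw [ex]; exact hux n) (by rw [ey]; exact hvy n)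
        rwa [ex, ey, ← (huv n).1, ← (huv n).2] at this
      have hx1 := (tendsto_add_atTop_iff_nat 1).2 hx
      have hy1 := (tendsto_add_atTop_iff_nat 1).2 hy
      have hdist := le_of_tendsto_of_tendsto'
        ((tendsto_const_nhds.dist hx1).add (tendsto_const_nhds.dist hy1))
        (((tendsto_const_nhds.dist hx).add (tendsto_const_nhds.dist hy)).const_mul k) hb
      simp only [dist_self, add_zero, mul_zero] at hdist
      have h1 := dist_nonneg (x := F x y) (y := x)
      have h2 := dist_nonneg (x := F y x) (y := y)
      exact ⟨dist_le_zero.1 (by linarith), dist_le_zero.1 (by linarith)⟩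
  refine ⟨(x, y), ⟨ex.symm, hF.1.symm, ey.symm, hF.2.symm⟩, ?_⟩
  rintro ⟨a, b⟩ ⟨ha, hFa, hb, hFb⟩
  dsimp only at ha hFa hb hFb
  obtain ⟨hxa, hyb⟩ := hlim (p := fun _ => a) (q := fun _ => b)
    fun _ => ⟨ha.symm.trans hFa, hb.symm.trans hFb⟩
  rw [← ha] at hxa
  rw [← hb] at hyb
  exact Prod.ext (tendsto_nhds_unique tendsto_const_nhds hxa)
    (tendsto_nhds_unique tendsto_const_nhds hyb)
end

section
/- Let (X,≤) be a partially ordered set with a metric d such that (X,d) is a complete metric space. Let F : X×X → X have the mixed monotone property and suppose there exists k ∈ [0,1) such that for all x,y,u,v ∈ X with x ≥ u and y ≤ v, d(F(x,y),F(u,v)) + d(F(y,x),F(v,u)) ≤ k·[d(x,u) + d(y,v)]. Assume either F is continuous or X satisfies Assumption (*). If there exist x₀, y₀ ∈ X with x₀ ≤ F(x₀,y₀) and y₀ ≥ F(y₀,x₀), or with x₀ ≥ F(x₀,y₀) and y₀ ≤ F(y₀,x₀), then F has a coupled fixed point: there exist x,y ∈ X with x = F(x,y) and y = F(y,x). -/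
open Filter Topology

/-- A coupled fixed point exists when the starting pair satisfies `x₀ ≤ F x₀ y₀` and
`F y₀ x₀ ≤ y₀`. -/
theorem exists_coupled_fixed_point_of_le
    {X : Type*} [MetricSpace X] [CompleteSpace X] [PartialOrder X]
    (F : X → X → X)
    (hmono : MixedGMonotone (id : X → X) F)
    (k : ℝ) (hk0 : 0 ≤ k) (hk1 : k < 1)
    (hcontr : ∀ x y u v : X, u ≤ x → y ≤ v →
      dist (F x y) (F u v) + dist (F y x) (F v u) ≤
        k * (dist x u + dist y v))
    (hcont_or_star : Continuous (Function.uncurry F) ∨ AssumptionStar X)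
    (x₀ y₀ : X) (hx₀ : x₀ ≤ F x₀ y₀) (hy₀ : F y₀ x₀ ≤ y₀) :
    ∃ x y : X, F x y = x ∧ F y x = y := by
  obtain ⟨a, b, ha0, hb0, ha, hb⟩ : ∃ a b : ℕ → X, a 0 = x₀ ∧ b 0 = y₀ ∧
      (∀ n, a (n + 1) = F (a n) (b n)) ∧ (∀ n, b (n + 1) = F (b n) (a n)) := by
    let T : X × X → X × X := fun p => (F p.1 p.2, F p.2 p.1)
    refine ⟨fun n => (T^[n] (x₀, y₀)).1, fun n => (T^[n] (x₀, y₀)).2, rfl, rfl, ?_, ?_⟩ <;>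
    · intro n
      simp only [Function.iterate_succ_apply', T]
  have hord : ∀ n, a n ≤ a (n + 1) ∧ b (n + 1) ≤ b n := by
    intro n
    induction n with
    | zero => rw [ha, hb, ha0, hb0]; exact ⟨hx₀, hy₀⟩
    | succ n ih =>
      rw [ha (n + 1), hb (n + 1)]
      constructor
      · calc a (n + 1) = F (a n) (b n) := ha n
          _ ≤ F (a (n + 1)) (b n) := hmono.1 _ _ _ ih.1
          _ ≤ F (a (n + 1)) (b (n + 1)) := hmono.2 _ _ _ ih.2
      · calc F (b (n + 1)) (a (n + 1)) ≤ F (b n) (a (n + 1)) := hmono.1 _ _ _ ih.2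
          _ ≤ F (b n) (a n) := hmono.2 _ _ _ ih.1
          _ = b (n + 1) := (hb n).symm
  have hdist : ∀ n, dist (a n) (a (n + 1)) + dist (b n) (b (n + 1)) ≤
      (dist (a 0) (a 1) + dist (b 0) (b 1)) * k ^ n := by
    intro n
    induction n with
    | zero => simp
    | succ n ih =>
      have h := hcontr _ _ _ _ (hord n).1 (hord n).2
      rw [← ha, ← hb, ← ha, ← hb] at h
      rw [dist_comm (a (n + 1 + 1)), dist_comm (b (n + 1 + 1)), dist_comm (a (n + 1)) (a n),
        dist_comm (b (n + 1)) (b n)] at h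
      have h' := mul_le_mul_of_nonneg_left ih hk0
      rw [pow_succ]
      linarith
  have hca : CauchySeq a := cauchySeq_of_le_geometric k _ hk1 fun n =>
    (le_add_of_nonneg_right dist_nonneg).trans (hdist n)
  have hcb : CauchySeq b := cauchySeq_of_le_geometric k _ hk1 fun n =>
    (le_add_of_nonneg_left dist_nonneg).trans (hdist n)
  obtain ⟨x, hx⟩ := cauchySeq_tendsto_of_complete hca
  obtain ⟨y, hy⟩ := cauchySeq_tendsto_of_complete hcb
  suffices h : Tendsto (fun n => F (a n) (b n)) atTop (𝓝 (F x y)) ∧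
      Tendsto (fun n => F (b n) (a n)) atTop (𝓝 (F y x)) by
    simp only [← ha, ← hb] at h
    exact ⟨x, y, tendsto_nhds_unique h.1 (hx.comp (tendsto_add_atTop_nat 1)),
      tendsto_nhds_unique h.2 (hy.comp (tendsto_add_atTop_nat 1))⟩
  rcases hcont_or_star with hF | hstar
  · exact ⟨(hF.tendsto (x, y)).comp (hx.prodMk_nhds hy),
      (hF.tendsto (y, x)).comp (hy.prodMk_nhds hx)⟩
  · have hax := hstar.1 a x (monotone_nat_of_le_succ fun n => (hord n).1) hx
    have hyb := hstar.2 b y (antitone_nat_of_succ_le fun n => (hord n).2) hy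
    have hlim : Tendsto (fun n => k * (dist x (a n) + dist y (b n))) atTop (𝓝 0) := by
      simpa using (((tendsto_const_nhds (x := x)).dist hx).add
        ((tendsto_const_nhds (x := y)).dist hy)).const_mul k
    have hle := fun n => hcontr x y (a n) (b n) (hax n) (hyb n)
    constructor <;> refine tendsto_iff_dist_tendsto_zero.2
      (squeeze_zero (fun _ => dist_nonneg) (fun n => ?_) hlim) <;> rw [dist_comm]
    · exact (le_add_of_nonneg_right dist_nonneg).trans (hle n)
    · exact (le_add_of_nonneg_left dist_nonneg).trans (hle n)

theorem coupled_fixed_point_of_symmetric_linear_contraction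
    {X : Type*} [MetricSpace X] [CompleteSpace X] [PartialOrder X]
    (F : X → X → X)
    (hmono : MixedGMonotone (id : X → X) F)
    (k : ℝ) (hk0 : 0 ≤ k) (hk1 : k < 1)
    (hcontr : ∀ x y u v : X, u ≤ x → y ≤ v →
      dist (F x y) (F u v) + dist (F y x) (F v u) ≤
        k * (dist x u + dist y v))
    (hcont_or_star : Continuous (Function.uncurry F) ∨ AssumptionStar X)
    (x₀ y₀ : X)
    (h0 : (x₀ ≤ F x₀ y₀ ∧ F y₀ x₀ ≤ y₀) ∨ (F x₀ y₀ ≤ x₀ ∧ y₀ ≤ F y₀ x₀)) :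
    ∃ x y : X, F x y = x ∧ F y x = y := by
  rcases h0 with ⟨hx, hy⟩ | ⟨hx, hy⟩
  · exact exists_coupled_fixed_point_of_le F hmono k hk0 hk1 hcontr hcont_or_star x₀ y₀ hx hy
  · exact exists_coupled_fixed_point_of_le F hmono k hk0 hk1 hcontr hcont_or_star y₀ x₀ hy hx
end

section
/- Let (X,≤) be a partially ordered set with a metric d such that (X,d) is a complete metric space, and let F : X×X → X be a continuous mapping having the mixed monotone property. Assume there exists a constant k ∈ [0,1) such that d(F(x,y),F(u,v)) ≤ (k/2)·[d(x,u) + d(y,v)] for all x,y,u,v ∈ X with x ≥ u and y ≤ v. If there exist x₀, y₀ ∈ X such that x₀ ≤ F(x₀,y₀) and y₀ ≥ F(y₀,x₀), then there exist x,y ∈ X such that x = F(x,y) and y = F(y,x). -/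
open Filter Topology

/-- The self-map `(x, y) ↦ (F x y, F y x)` of `X × X`, whose fixed points are the coupled fixed
points of `F`. -/
def coupledMap {X : Type*} (F : X → X → X) (p : X × X) : X × X :=
  (F p.1 p.2, F p.2 p.1)

theorem continuous_coupledMap {X : Type*} [TopologicalSpace X] {F : X → X → X}
    (hF : Continuous (Function.uncurry F)) : Continuous (coupledMap F) :=
  hF.prodMk (hF.comp continuous_swap)

theorem PairLe.coupledMap {X : Type*} [Preorder X] {F : X → X → X}
    (hF : MixedGMonotone id F) {p q : X × X} (h : PairLe p q) :
    PairLe (coupledMap F p) (coupledMap F q) :=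
  ⟨(hF.1 _ _ _ h.1).trans (hF.2 _ _ _ h.2), (hF.2 _ _ _ h.1).trans (hF.1 _ _ _ h.2)⟩

theorem dist_coupledMap_le {X : Type*} [MetricSpace X] [Preorder X] {F : X → X → X}
    {k : ℝ} (hk0 : 0 ≤ k)
    (hcontr : ∀ x y u v : X, u ≤ x → y ≤ v →
      dist (F x y) (F u v) ≤ k / 2 * (dist x u + dist y v))
    {p q : X × X} (h : PairLe p q) :
    dist (coupledMap F p) (coupledMap F q) ≤ k * dist p q := by
  have h₁ : dist p.1 q.1 ≤ dist p q := le_max_left _ _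
  have h₂ : dist p.2 q.2 ≤ dist p q := le_max_right _ _
  have hsum : k / 2 * (dist p.1 q.1 + dist p.2 q.2) ≤ k * dist p q := by
    nlinarith
  refine max_le (le_trans ?_ hsum) (le_trans ?_ hsum)
  · simpa only [coupledMap, dist_comm] using hcontr q.1 q.2 p.1 p.2 h.1 h.2
  · simpa only [coupledMap, add_comm] using hcontr p.2 p.1 q.2 q.1 h.2 h.1

/-- If `f` contracts distances along an orbit by a factor `k < 1`, the orbit converges to a fixed
point of `f`. -/
theorem exists_isFixedPt_of_dist_iterate_le {Y : Type*} [MetricSpace Y] [CompleteSpace Y]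
    {f : Y → Y} (hf : Continuous f) {k : ℝ} (hk0 : 0 ≤ k) (hk1 : k < 1) (p : Y)
    (h : ∀ n, dist (f^[n + 1] p) (f^[n + 2] p) ≤ k * dist (f^[n] p) (f^[n + 1] p)) :
    ∃ q, Function.IsFixedPt f q := by
  have hgeom : ∀ n, dist (f^[n] p) (f^[n + 1] p) ≤ dist p (f p) * k ^ n := by
    intro n
    induction n with
    | zero => simp
    | succ n ih =>
      calc _ ≤ k * dist (f^[n] p) (f^[n + 1] p) := h n
        _ ≤ k * (dist p (f p) * k ^ n) := by gcongr
        _ = dist p (f p) * k ^ (n + 1) := by ring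
  obtain ⟨q, hq⟩ := cauchySeq_tendsto_of_complete (cauchySeq_of_le_geometric k _ hk1 hgeom)
  exact ⟨q, isFixedPt_of_tendsto_iterate hq hf.continuousAt⟩

theorem coupled_fixed_point_bhaskar_lakshmikantham
    {X : Type*} [MetricSpace X] [CompleteSpace X] [PartialOrder X]
    (F : X → X → X)
    (hFcont : Continuous (Function.uncurry F))
    (hmono : MixedGMonotone (id : X → X) F)
    (k : ℝ) (hk0 : 0 ≤ k) (hk1 : k < 1)
    (hcontr : ∀ x y u v : X, u ≤ x → y ≤ v →
      dist (F x y) (F u v) ≤ k / 2 * (dist x u + dist y v))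
    (x₀ y₀ : X)
    (h0 : x₀ ≤ F x₀ y₀ ∧ F y₀ x₀ ≤ y₀) :
    ∃ x y : X, x = F x y ∧ y = F y x := by
  have hle : ∀ n, PairLe ((coupledMap F)^[n] (x₀, y₀)) ((coupledMap F)^[n + 1] (x₀, y₀)) := by
    intro n
    induction n with
    | zero => exact h0
    | succ n ih =>
      simpa only [Function.iterate_succ_apply'] using ih.coupledMap hmono
  obtain ⟨q, hq⟩ := exists_isFixedPt_of_dist_iterate_le (continuous_coupledMap hFcont) hk0 hk1
    (x₀, y₀) fun n => by
      simpa only [Function.iterate_succ_apply'] using dist_coupledMap_le hk0 hcontr (hle n)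
  exact ⟨q.1, q.2, congrArg Prod.fst hq.symm, congrArg Prod.snd hq.symm⟩
end

section
/- Let (X,≤) be a partially ordered set with a metric d. Let g : X → X and let F : X×X → X have the mixed g-monotone property, and suppose there exists φ ∈ Φ such that for all x,y,u,v ∈ X with g(x) ≥ g(u) and g(y) ≤ g(v), d(F(x,y),F(u,v)) + d(F(y,x),F(v,u)) ≤ 2·φ((d(g(x),g(u)) + d(g(y),g(v)))/2). Suppose sequences {xₙ}, {yₙ} in X satisfy g(xₙ₊₁) = F(xₙ,yₙ) and g(yₙ₊₁) = F(yₙ,xₙ) for all n ≥ 0, with g(x₀) ≤ F(x₀,y₀) and g(y₀) ≥ F(y₀,x₀). Then {g(xₙ)} and {g(yₙ)} are Cauchy sequences in (X,d). -/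
open Filter Topology

/-- A Meir–Keeler shift condition forces consecutive distances to tend to zero. -/
theorem tendsto_dist_succ_of_meirKeeler {α : Type*} [PseudoMetricSpace α] {u : ℕ → α}
    (h : ∀ ε > 0, ∃ η > 0, ∀ n m, dist (u n) (u m) < ε + η → dist (u (n + 1)) (u (m + 1)) < ε) :
    Tendsto (fun n => dist (u n) (u (n + 1))) atTop (𝓝 0) := by
  have hanti : Antitone fun n => dist (u n) (u (n + 1)) := by
    refine antitone_nat_of_succ_le fun n => le_of_forall_gt fun ε hε => ?_
    obtain ⟨η, hη, H⟩ := h ε (dist_nonneg.trans_lt hε)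
    exact H _ _ (by linarith)
  have hbdd : BddBelow (Set.range fun n => dist (u n) (u (n + 1))) :=
    ⟨0, by rintro _ ⟨n, rfl⟩; exact dist_nonneg⟩
  have hlim := tendsto_atTop_ciInf hanti hbdd
  set L := ⨅ n, dist (u n) (u (n + 1))
  have hL0 : 0 ≤ L := le_ciInf fun n => dist_nonneg
  rcases hL0.eq_or_lt with h0 | hpos
  · rwa [← h0] at hlim
  · obtain ⟨η, hη, H⟩ := h L hpos
    obtain ⟨n, hn⟩ := (hlim.eventually_lt_const (show L < L + η by linarith)).exists
    exact absurd (H _ _ hn) (not_lt.2 (ciInf_le hbdd (n + 1)))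

/-- A sequence satisfying a Meir–Keeler shift condition is Cauchy. -/
theorem cauchySeq_of_meirKeeler {α : Type*} [PseudoMetricSpace α] {u : ℕ → α}
    (h : ∀ ε > 0, ∃ η > 0, ∀ n m, dist (u n) (u m) < ε + η → dist (u (n + 1)) (u (m + 1)) < ε) :
    CauchySeq u := by
  refine Metric.cauchySeq_iff'.2 fun ε hε => ?_
  obtain ⟨η, hη, H⟩ := h (ε / 2) (half_pos hε)
  obtain ⟨N, hN⟩ := ((tendsto_dist_succ_of_meirKeeler h).eventually_lt_const
    (show 0 < min η (ε / 2) from lt_min hη (half_pos hε))).exists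
  have key : ∀ m, N ≤ m → dist (u N) (u m) < ε / 2 + min η (ε / 2) := by
    intro m hm
    induction m, hm using Nat.le_induction with
    | base =>
      rw [dist_self]
      positivity
    | succ m _ ih =>
      have := H N m (ih.trans_le (by gcongr; exact min_le_left _ _))
      linarith [dist_triangle (u N) (u (N + 1)) (u (m + 1))]
  refine ⟨N, fun n hn => ?_⟩
  rw [dist_comm]
  linarith [key n hn, min_le_right η (ε / 2)]

theorem IsPhiFun.exists_lt {φ : ℝ → ℝ} (hφ : IsPhiFun φ) {ε : ℝ} (hε : 0 < ε) :
    ∃ η > 0, ∀ t, 0 < t → t < ε + η → φ t < ε := by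
  obtain ⟨L, hL, hlim⟩ := hφ.2.2 ε hε
  obtain ⟨b, hb, H⟩ := mem_nhdsGT_iff_exists_Ioo_subset.1 (hlim.eventually_lt_const hL)
  refine ⟨b - ε, sub_pos.2 hb, fun t ht htb => ?_⟩
  rcases le_or_gt t ε with h | h
  · exact (hφ.2.1 t ht).trans_le h
  · exact H ⟨h, by linarith⟩

/-- Under the mixed `g`-monotone property, `F` factors through `g` in both arguments. -/
theorem MixedGMonotone.congr {X : Type*} [PartialOrder X] {g : X → X} {F : X → X → X}
    (h : MixedGMonotone g F) {x y u v : X} (hx : g x = g u) (hy : g y = g v) :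
    F x y = F u v :=
  ((h.1 y x u hx.le).antisymm (h.1 y u x hx.ge)).trans
    ((h.2 u v y hy.ge).antisymm (h.2 u y v hy.le))

theorem MixedGMonotone.le {X : Type*} [Preorder X] {g : X → X} {F : X → X → X}
    (h : MixedGMonotone g F) {x y u v : X} (hx : g u ≤ g x) (hy : g y ≤ g v) :
    F u v ≤ F x y :=
  (h.1 v u x hx).trans (h.2 x y v hy)

theorem picard_sequences_cauchy
    {X : Type*} [MetricSpace X] [PartialOrder X]
    (F : X → X → X) (g : X → X)
    (hmono : MixedGMonotone g F)
    (φ : ℝ → ℝ) (hφ : IsPhiFun φ)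
    (hcontr : ∀ x y u v : X, g u ≤ g x → g y ≤ g v →
      dist (F x y) (F u v) + dist (F y x) (F v u) ≤
        2 * φ ((dist (g x) (g u) + dist (g y) (g v)) / 2))
    (x y : ℕ → X)
    (hx : ∀ n : ℕ, g (x (n + 1)) = F (x n) (y n))
    (hy : ∀ n : ℕ, g (y (n + 1)) = F (y n) (x n))
    (h0x : g (x 0) ≤ F (x 0) (y 0))
    (h0y : F (y 0) (x 0) ≤ g (y 0)) :
    CauchySeq (fun n => g (x n)) ∧ CauchySeq (fun n => g (y n)) := by
  have hstep : ∀ n, g (x n) ≤ g (x (n + 1)) ∧ g (y (n + 1)) ≤ g (y n) := by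
    intro n
    induction n with
    | zero => exact ⟨(hx 0).symm ▸ h0x, (hy 0).symm ▸ h0y⟩
    | succ n ih =>
      rw [hx (n + 1), hy (n + 1), hx n, hy n]
      exact ⟨hmono.le ih.1 ih.2, hmono.le ih.2 ih.1⟩
  have hxm : Monotone fun n => g (x n) := monotone_nat_of_le_succ fun n => (hstep n).1
  have hym : Antitone fun n => g (y n) := antitone_nat_of_succ_le fun n => (hstep n).2
  let u : ℕ → WithLp 1 (X × X) := fun n => WithLp.toLp 1 (g (x n), g (y n))
  have hu : ∀ n m, dist (u n) (u m) = dist (g (x n)) (g (x m)) + dist (g (y n)) (g (y m)) :=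
    fun n m => by simp [u, WithLp.prod_dist_eq_add (p := 1) (by simp)]
  have hcauchy : CauchySeq u := by
    refine cauchySeq_of_meirKeeler fun ε hε => ?_
    obtain ⟨η, hη, H⟩ := hφ.exists_lt (half_pos hε)
    refine ⟨2 * η, by positivity, fun n m hnm => ?_⟩
    wlog hle : m ≤ n generalizing n m
    · rw [dist_comm] at hnm ⊢
      exact this m n hnm (le_of_not_ge hle)
    rcases (dist_nonneg (x := u n) (y := u m)).eq_or_lt with h0 | hpos
    · have hinj := dist_eq_zero.1 h0.symm
      have hgx : g (x n) = g (x m) := congrArg (fun p => p.fst) hinj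
      have hgy : g (y n) = g (y m) := congrArg (fun p => p.snd) hinj
      rw [hu, hx n, hx m, hy n, hy m, hmono.congr hgx hgy, hmono.congr hgy hgx]
      simpa using hε
    · have hc := hcontr (x n) (y n) (x m) (y m) (hxm hle) (hym hle)
      rw [← hx, ← hx, ← hy, ← hy, ← hu, ← hu] at hc
      linarith [H (dist (u n) (u m) / 2) (half_pos hpos) (by linarith)]
  rw [Metric.cauchySeq_iff] at hcauchy
  simp only [Metric.cauchySeq_iff]
  refine ⟨fun ε hε => ?_, fun ε hε => ?_⟩ <;>
  · obtain ⟨N, hN⟩ := hcauchy ε hε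
    refine ⟨N, fun m hm n hn => lt_of_le_of_lt ?_ (hN m hm n hn)⟩
    rw [hu]
    simp
end
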